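/- arXiv:2409.18801 — 3 statements merged into one kernel-verified Lean document; each statement's English description precedes it below -/
import Mathlib

section
/- Let H be a real Hilbert space, let (e_i)_{i∈ℕ} be a Hilbert (orthonormal) basis of H, let μ : ℕ → ℝ be a nonincreasing sequence of nonnegative numbers, and let K : H → H be a bounded self-adjoint operator with K e_i = μ_i e_i for all i. Then for every suborthonormal family {φ_1,…,φ_n} in H one has ∑_{i=1}^n ⟨K φ_i, φ_i⟩ ≤ ∑_{i=1}^n μ_i. -/
open scoped BigOperators

/-- If `K` is a bounded self-adjoint operator on a real Hilbert space which is diagonal in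
a Hilbert basis `(e_i)` with nonincreasing nonnegative eigenvalues `μ_i`, then for every
suborthonormal family `φ_1, …, φ_n` one has `∑_{i<n} ⟨K φ_i, φ_i⟩ ≤ ∑_{i<n} μ_i`. -/
theorem trace_bound_suborthonormal {H : Type*}
    [NormedAddCommGroup H] [InnerProductSpace ℝ H] [CompleteSpace H]
    (e : HilbertBasis ℕ ℝ H) (μ : ℕ → ℝ)
    (hμ_anti : Antitone μ) (hμ_nonneg : ∀ i, 0 ≤ μ i)
    (K : H →L[ℝ] H) (hK : IsSelfAdjoint K) (hKe : ∀ i, K (e i) = μ i • e i)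
    {n : ℕ} (φ : Fin n → H)
    (hsub : ∀ ξ : Fin n → ℝ,
      ∑ i, ∑ j, ξ i * ξ j * (inner ℝ (φ i) (φ j) : ℝ) ≤ ∑ i, (ξ i) ^ 2) :
    ∑ i : Fin n, (inner ℝ (K (φ i)) (φ i) : ℝ) ≤ ∑ i ∈ Finset.range n, μ i := by
  have hdiag : ∀ i, (inner ℝ (φ i) (φ i) : ℝ) ≤ 1 := by
    intro i
    have h := hsub (Pi.single i 1)
    simpa [Pi.single_apply, Finset.sum_ite_eq] using h
  set c : ℕ → ℝ := fun k => ∑ i, (inner ℝ (φ i) (e k) : ℝ) ^ 2 with hc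
  have hc0 : ∀ k, 0 ≤ c k := fun k => Finset.sum_nonneg fun i _ => sq_nonneg _
  have hc1 : ∀ k, c k ≤ 1 := by
    intro k
    set v : H := ∑ i, (inner ℝ (φ i) (e k) : ℝ) • φ i with hv
    have h1 : (inner ℝ v v : ℝ) ≤ c k := by
      have h := hsub (fun i => inner ℝ (φ i) (e k))
      refine le_trans (le_of_eq ?_) h
      rw [hv, sum_inner]
      refine Finset.sum_congr rfl fun i _ => ?_
      rw [inner_sum]
      refine Finset.sum_congr rfl fun j _ => ?_
      rw [real_inner_smul_left, real_inner_smul_right]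
      ring
    have h2 : (inner ℝ v (e k) : ℝ) = c k := by
      rw [hv, sum_inner]
      refine Finset.sum_congr rfl fun i _ => ?_
      rw [real_inner_smul_left]
      ring
    have h3 := real_inner_mul_inner_self_le v (e k)
    have h4 : (inner ℝ (e k) (e k) : ℝ) = 1 := by
      rw [real_inner_self_eq_norm_sq, e.orthonormal.1 k]; norm_num
    rw [h2, h4] at h3
    by_contra! h5
    nlinarith
  have hsum1 : HasSum c (∑ i, (inner ℝ (φ i) (φ i) : ℝ)) := by
    refine hasSum_sum fun i _ => ?_
    refine Eq.mp (congrArg (fun f => HasSum f _) (funext fun k => ?_)) (e.hasSum_inner_mul_inner (φ i) (φ i))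
    rw [real_inner_comm (φ i) (e k)]
    ring
  have hsum2 : HasSum (fun k => μ k * c k) (∑ i, (inner ℝ (K (φ i)) (φ i) : ℝ)) := by
    simp only [hc, Finset.mul_sum]
    refine hasSum_sum fun i _ => ?_
    refine Eq.mp (congrArg (fun f => HasSum f _) (funext fun k => ?_)) (e.hasSum_inner_mul_inner (K (φ i)) (φ i))
    have : (inner ℝ (K (φ i)) (e k) : ℝ) = inner ℝ (φ i) (K (e k)) :=
      hK.isSymmetric (φ i) (e k)
    rw [this, hKe, real_inner_smul_right, real_inner_comm (φ i) (e k)]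
    ring
  have hf := hsum2.sub (hsum1.mul_left (μ n))
  have hg : HasSum (fun k => if k ∈ Finset.range n then μ k - μ n else 0)
      (∑ k ∈ Finset.range n, (if k ∈ Finset.range n then μ k - μ n else 0)) :=
    hasSum_sum_of_ne_finset_zero fun k hk => if_neg hk
  have hle := hasSum_le (fun k => ?_) hf hg
  · rw [Finset.sum_congr rfl (g := fun k => μ k - μ n) (fun k hk => if_pos hk),
      Finset.sum_sub_distrib] at hle
    simp only [Finset.sum_const, Finset.card_range, nsmul_eq_mul] at hle
    have hn : ∑ i, (inner ℝ (φ i) (φ i) : ℝ) ≤ n := by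
      refine (Finset.sum_le_sum fun i _ => hdiag i).trans ?_
      simp
    nlinarith [mul_le_mul_of_nonneg_left hn (hμ_nonneg n)]
  · split_ifs with hk
    · have := hμ_anti (Finset.mem_range.1 hk).le
      nlinarith [hc1 k]
    · have := hμ_anti (not_lt.1 (fun h => hk (Finset.mem_range.2 h)))
      nlinarith [hc0 k]
end

section
/- Let H be a real Hilbert space, (e_j)_{j≥1} a Hilbert (orthonormal) basis of H, c > 0, and λ : {1,2,…} → ℝ a sequence with λ_j ≥ c·j for all j ≥ 1. Let K : H → H be the bounded self-adjoint operator with K e_j = λ_j^{-1} e_j. Then for every suborthonormal family {θ_1,…,θ_n} in H one has ∑_{j=1}^n ⟨K θ_j, θ_j⟩ ≤ (1/c)(1 + ln n). -/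
open scoped BigOperators

/-- If `K` is the bounded self-adjoint operator diagonal in a Hilbert basis `(e_j)_{j≥1}`
with eigenvalues `λ_j⁻¹`, where `λ_j ≥ c·j`, then for every suborthonormal family
`θ_1, …, θ_n` one has `∑_{j=1}^n ⟨K θ_j, θ_j⟩ ≤ (1/c)(1 + ln n)`.
(The basis is indexed by `ℕ`, with `e j` corresponding to the `(j+1)`-st basis vector.) -/
theorem trace_log_bound_suborthonormal {H : Type*}
    [NormedAddCommGroup H] [InnerProductSpace ℝ H] [CompleteSpace H]
    (e : HilbertBasis ℕ ℝ H) (c : ℝ) (hc : 0 < c) (lam : ℕ → ℝ)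
    (hlam : ∀ j : ℕ, 1 ≤ j → c * (j : ℝ) ≤ lam j)
    (K : H →L[ℝ] H) (hK : IsSelfAdjoint K)
    (hKe : ∀ j : ℕ, K (e j) = (lam (j + 1))⁻¹ • e j)
    {n : ℕ} (hn : 1 ≤ n) (θ : Fin n → H)
    (hsub : ∀ ξ : Fin n → ℝ,
      ∑ i, ∑ j, ξ i * ξ j * (inner ℝ (θ i) (θ j) : ℝ) ≤ ∑ i, (ξ i) ^ 2) :
    ∑ j : Fin n, (inner ℝ (K (θ j)) (θ j) : ℝ) ≤ (1 / c) * (1 + Real.log n) := by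
  have hn0 : (0 : ℝ) < n := by exact_mod_cast hn
  set w : ℕ → ℝ := fun k => ∑ i : Fin n, (inner ℝ (e k) (θ i) : ℝ) ^ 2 with hw
  have hw0 : ∀ k, 0 ≤ w k := fun k => Finset.sum_nonneg fun i _ => sq_nonneg _
  have hw1 : ∀ k, w k ≤ 1 := by
    intro k
    set v : H := ∑ i : Fin n, (inner ℝ (e k) (θ i) : ℝ) • θ i with hv
    have h1 : (inner ℝ (e k) v : ℝ) = w k := by
      simp only [hv, hw, inner_sum, inner_smul_right, sq]
    have h2 : ‖v‖ ^ 2 ≤ w k := by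
      have h := hsub (fun i => inner ℝ (e k) (θ i))
      rw [← real_inner_self_eq_norm_sq]
      refine le_trans (le_of_eq ?_) h
      simp only [hv, inner_sum, sum_inner, inner_smul_left, inner_smul_right, Finset.mul_sum]
      rw [Finset.sum_comm]
      refine Finset.sum_congr rfl fun i _ => Finset.sum_congr rfl fun j _ => ?_
      simp
      ring
    have h3 : w k ≤ ‖v‖ := by
      rw [← h1]
      have h := real_inner_le_norm (e k) v
      rwa [e.orthonormal.1 k, one_mul] at h
    nlinarith [hw0 k, norm_nonneg v]
  have hθ : ∀ i, ‖θ i‖ ^ 2 ≤ 1 := by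
    intro i
    have h := hsub (Pi.single i 1)
    rw [← real_inner_self_eq_norm_sq]
    simpa [Pi.single_apply, ite_mul, mul_ite, ite_pow] using h
  have hws : HasSum w (∑ i : Fin n, ‖θ i‖ ^ 2) := by
    refine hasSum_sum fun i _ => ?_
    have h := e.hasSum_inner_mul_inner (θ i) (θ i)
    rw [real_inner_self_eq_norm_sq] at h
    refine h.congr_fun ?_
    intro k
    rw [real_inner_comm, sq]
  have hKs : HasSum (fun k => (lam (k + 1))⁻¹ * w k)
      (∑ j : Fin n, (inner ℝ (K (θ j)) (θ j) : ℝ)) := by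
    simp only [hw, Finset.mul_sum]
    refine hasSum_sum fun i _ => ?_
    refine (e.hasSum_inner_mul_inner (K (θ i)) (θ i)).congr_fun ?_
    intro k
    have h : (inner ℝ (K (θ i)) (e k) : ℝ) = inner ℝ (θ i) (K (e k)) :=
      hK.isSymmetric (θ i) (e k)
    rw [h, hKe, inner_smul_right, real_inner_comm (e k) (θ i)]
    ring
  set a : ℕ → ℝ := fun k => (c * ((k : ℝ) + 1))⁻¹ with ha
  set m : ℝ := (c * n)⁻¹ with hm
  have hm0 : 0 ≤ m := by positivity
  have hla : ∀ k, (lam (k + 1))⁻¹ ≤ a k := by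
    intro k
    have h := hlam (k + 1) (by omega)
    push_cast at h
    exact inv_anti₀ (by positivity) h
  have hg : HasSum (fun k => m * w k + if k ∈ Finset.range n then a k - m else 0)
      (m * (∑ i : Fin n, ‖θ i‖ ^ 2) + ∑ k ∈ Finset.range n, (a k - m)) := by
    refine (hws.mul_left m).add ?_
    have h := hasSum_sum_of_ne_finset_zero (f := fun k => if k ∈ Finset.range n then a k - m else 0)
      (s := Finset.range n) (L := SummationFilter.unconditional ℕ) (fun b hb => if_neg hb)
    rwa [Finset.sum_congr rfl (fun k hk => if_pos hk)] at h
  have hle := hasSum_le (fun k => ?_) hKs hg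
  · have hsum : ∑ i : Fin n, ‖θ i‖ ^ 2 ≤ n := by
      have h := Finset.sum_le_sum (fun i (_ : i ∈ Finset.univ) => hθ i)
      simpa using h
    have hH := harmonic_le_one_add_log n
    have hA : ∑ k ∈ Finset.range n, a k = (1 / c) * (harmonic n : ℝ) := by
      simp only [ha, harmonic, mul_inv, ← Finset.mul_sum]
      push_cast
      rw [one_div]
    rw [Finset.sum_sub_distrib, hA] at hle
    simp only [Finset.sum_const, Finset.card_range, nsmul_eq_mul] at hle
    have h1 := mul_le_mul_of_nonneg_left hsum hm0
    have h2 := mul_le_mul_of_nonneg_left hH (show 0 ≤ 1 / c by positivity)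
    linarith
  · have h1 := mul_le_mul_of_nonneg_right (hla k) (hw0 k)
    refine h1.trans ?_
    split_ifs with hk
    · have hkn : (k : ℝ) + 1 ≤ n := by exact_mod_cast Finset.mem_range.1 hk
      have h2 : m ≤ a k := inv_anti₀ (by positivity) (by gcongr)
      nlinarith [hw1 k]
    · have hkn : (n : ℝ) ≤ (k : ℝ) + 1 := by
        have : n ≤ k + 1 := by have := Finset.mem_range.not.1 hk; omega
        exact_mod_cast this
      have h2 : a k ≤ m := inv_anti₀ (by positivity) (by gcongr)
      nlinarith [hw0 k]
end

section
/- Let d ≥ 3 be an integer, M > 0, let H be a real Hilbert space with Hilbert (orthonormal) basis (e_j)_{j≥1}, let μ : {1,2,…} → ℝ be a nonincreasing sequence of nonnegative numbers with μ_j ≤ M j^{-2/d} for all j, and let K : H → H be the bounded self-adjoint operator with K e_j = μ_j e_j. Then for every suborthonormal family {ψ_1,…,ψ_n} in H one has ∑_{j=1}^n ⟨K ψ_j, ψ_j⟩ ≤ M (d/(d−2)) n^{(d−2)/d}. -/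
open scoped BigOperators

lemma hasSum_of_pointwise {f g : ℕ → ℝ} {x : ℝ} (h : ∀ j, f j = g j) (hg : HasSum g x) :
    HasSum f x := by
  rw [funext h]
  exact hg

lemma rpow_step (s : ℝ) (h0 : 0 ≤ s) (h1 : s ≤ 1) (k : ℕ) :
    s * ((k : ℝ) + 1) ^ (s - 1) + (k : ℝ) ^ s ≤ ((k : ℝ) + 1) ^ s := by
  have hk : (0 : ℝ) < (k : ℝ) + 1 := by positivity
  have hx : (-1 : ℝ) ≤ -(1 / ((k : ℝ) + 1)) := by
    have : 1 / ((k : ℝ) + 1) ≤ 1 := by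
      rw [div_le_one hk]
      linarith [Nat.cast_nonneg (α := ℝ) k]
    linarith
  have hb := rpow_one_add_le_one_add_mul_self hx h0 h1
  have e1 : 1 + -(1 / ((k : ℝ) + 1)) = (k : ℝ) / ((k : ℝ) + 1) := by
    field_simp
    ring
  rw [e1, Real.div_rpow (Nat.cast_nonneg k) hk.le, div_le_iff₀ (Real.rpow_pos_of_pos hk s)] at hb
  rw [Real.rpow_sub_one hk.ne']
  have e2 : (1 + s * -(1 / ((k : ℝ) + 1))) * ((k : ℝ) + 1) ^ s
      = ((k : ℝ) + 1) ^ s - s * (((k : ℝ) + 1) ^ s / ((k : ℝ) + 1)) := by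
    ring
  linarith

lemma sum_rpow_bound (s : ℝ) (h0 : 0 < s) (h1 : s ≤ 1) (n : ℕ) :
    s * ∑ j ∈ Finset.range n, ((j : ℝ) + 1) ^ (s - 1) ≤ (n : ℝ) ^ s := by
  induction n with
  | zero => simp [Real.zero_rpow h0.ne']
  | succ k ih =>
    rw [Finset.sum_range_succ, mul_add]
    have := rpow_step s h0.le h1 k
    push_cast
    linarith

lemma coeff_le_one {H : Type*} [NormedAddCommGroup H] [InnerProductSpace ℝ H]
    {n : ℕ} (ψ : Fin n → H)
    (hsub : ∀ ξ : Fin n → ℝ,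
      ∑ i, ∑ j, ξ i * ξ j * (inner ℝ (ψ i) (ψ j) : ℝ) ≤ ∑ i, (ξ i) ^ 2)
    (v : H) (hv : ‖v‖ = 1) : ∑ i, (inner ℝ v (ψ i) : ℝ) ^ 2 ≤ 1 := by
  set S := ∑ i, (inner ℝ v (ψ i) : ℝ) ^ 2 with hS
  set w : H := ∑ i, (inner ℝ v (ψ i) : ℝ) • ψ i with hw
  have h1 : (inner ℝ v w : ℝ) = S := by
    rw [hw, inner_sum, hS]
    refine Finset.sum_congr rfl fun i _ => ?_
    rw [real_inner_smul_right, sq]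
  have h2 : ‖w‖ ^ 2 ≤ S := by
    refine le_trans (le_of_eq ?_) (hsub fun i => inner ℝ v (ψ i))
    rw [← real_inner_self_eq_norm_sq, hw, sum_inner]
    refine Finset.sum_congr rfl fun i _ => ?_
    rw [inner_sum]
    refine Finset.sum_congr rfl fun j _ => ?_
    rw [real_inner_smul_left, real_inner_smul_right, mul_assoc]
  have h3 : S ≤ ‖w‖ := by
    have := real_inner_le_norm v w
    rwa [h1, hv, one_mul] at this
  have h4 : 0 ≤ S := Finset.sum_nonneg fun i _ => sq_nonneg _
  nlinarith

/-- If `K` is the bounded self-adjoint operator diagonal in a Hilbert basis `(e_j)_{j≥1}`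
with nonincreasing nonnegative eigenvalues `μ_j ≤ M j^{-2/d}` (`d ≥ 3`), then for every
suborthonormal family `ψ_1, …, ψ_n` one has
`∑_{j=1}^n ⟨K ψ_j, ψ_j⟩ ≤ M (d/(d−2)) n^{(d−2)/d}`.
(The basis is indexed by `ℕ`, with `e j` corresponding to the `(j+1)`-st basis vector.) -/
theorem trace_power_bound_suborthonormal (d : ℕ) (hd : 3 ≤ d) (M : ℝ) (hM : 0 < M)
    {H : Type*} [NormedAddCommGroup H] [InnerProductSpace ℝ H] [CompleteSpace H]
    (e : HilbertBasis ℕ ℝ H) (μ : ℕ → ℝ)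
    (hnonneg : ∀ j, 0 ≤ μ j)
    (hanti : ∀ j k, 1 ≤ j → j ≤ k → μ k ≤ μ j)
    (hbound : ∀ j : ℕ, 1 ≤ j → μ j ≤ M * (j : ℝ) ^ (-(2 : ℝ) / d))
    (K : H →L[ℝ] H) (hK : IsSelfAdjoint K)
    (hKe : ∀ j : ℕ, K (e j) = μ (j + 1) • e j)
    {n : ℕ} (ψ : Fin n → H)
    (hsub : ∀ ξ : Fin n → ℝ,
      ∑ i, ∑ j, ξ i * ξ j * (inner ℝ (ψ i) (ψ j) : ℝ) ≤ ∑ i, (ξ i) ^ 2) :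
    ∑ j : Fin n, (inner ℝ (K (ψ j)) (ψ j) : ℝ) ≤
      M * ((d : ℝ) / ((d : ℝ) - 2)) * (n : ℝ) ^ (((d : ℝ) - 2) / d) := by
  have hd' : (3 : ℝ) ≤ d := by exact_mod_cast hd
  have hψ : ∀ i, ‖ψ i‖ ^ 2 ≤ 1 := by
    intro i
    have := hsub (Pi.single i 1)
    simpa [Pi.single_apply] using this
  set a : ℕ → ℝ := fun j => ∑ i, (inner ℝ (e j) (ψ i) : ℝ) ^ 2 with ha
  have ha0 : ∀ j, 0 ≤ a j := fun j => Finset.sum_nonneg fun i _ => sq_nonneg _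
  have ha1 : ∀ j, a j ≤ 1 := fun j => coeff_le_one ψ hsub (e j) (e.orthonormal.1 j)
  have hs1 : HasSum a (∑ i, ‖ψ i‖ ^ 2) := by
    refine hasSum_sum fun i _ => ?_
    have := e.hasSum_inner_mul_inner (ψ i) (ψ i)
    rw [real_inner_self_eq_norm_sq] at this
    refine hasSum_of_pointwise ?_ this
    intro j
    rw [real_inner_comm (e j) (ψ i), sq]
  have hs2 : HasSum (fun j => μ (j + 1) * a j) (∑ i, (inner ℝ (K (ψ i)) (ψ i) : ℝ)) := by
    simp only [ha, Finset.mul_sum]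
    refine hasSum_sum fun i _ => ?_
    have := e.hasSum_inner_mul_inner (K (ψ i)) (ψ i)
    refine hasSum_of_pointwise ?_ this
    intro j
    have h : (inner ℝ (K (ψ i)) (e j) : ℝ) = inner ℝ (ψ i) (K (e j)) := hK.isSymmetric _ _
    rw [h, hKe, real_inner_smul_right, real_inner_comm]
    ring
  have hsum : ∑ i, ‖ψ i‖ ^ 2 ≤ (n : ℝ) := by
    refine (Finset.sum_le_sum fun i _ => hψ i).trans (by simp)
  have hs3 := hs2.sub (hs1.mul_left (μ (n + 1)))
  have hle : ∑ i, (inner ℝ (K (ψ i)) (ψ i) : ℝ) - μ (n + 1) * ∑ i, ‖ψ i‖ ^ 2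
      ≤ ∑ j ∈ Finset.range n, (μ (j + 1) - μ (n + 1)) := by
    have hf : HasSum (fun j => if j ∈ Finset.range n then μ (j + 1) - μ (n + 1) else 0)
        (∑ j ∈ Finset.range n, (μ (j + 1) - μ (n + 1))) := by
      have := hasSum_sum_of_ne_finset_zero
        (f := fun j => if j ∈ Finset.range n then μ (j + 1) - μ (n + 1) else 0)
        (s := Finset.range n) (L := .unconditional ℕ) (fun b hb => if_neg hb)
      rwa [Finset.sum_congr rfl (fun j hj => if_pos hj)] at this
    refine hasSum_le (fun j => ?_) hs3 hf
    by_cases hj : j < n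
    · have := hanti (j + 1) (n + 1) (by omega) (by omega)
      simp only [Finset.mem_range, hj, if_true]
      nlinarith [ha1 j]
    · have := hanti (n + 1) (j + 1) (by omega) (by omega)
      simp only [Finset.mem_range, hj, if_false]
      nlinarith [ha0 j]
  rw [Finset.sum_sub_distrib, Finset.sum_const, Finset.card_range, nsmul_eq_mul] at hle
  have hc := mul_le_mul_of_nonneg_left hsum (hnonneg (n + 1))
  have htr : ∑ i, (inner ℝ (K (ψ i)) (ψ i) : ℝ) ≤ ∑ j ∈ Finset.range n, μ (j + 1) := by
    linarith
  set s : ℝ := ((d : ℝ) - 2) / d with hs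
  have hs0 : 0 < s := div_pos (by linarith) (by linarith)
  have hsle : s ≤ 1 := by
    rw [hs, div_le_one (by linarith)]
    linarith
  have hse : -(2 : ℝ) / d = s - 1 := by
    rw [hs]
    field_simp
    ring
  have hinv : (d : ℝ) / ((d : ℝ) - 2) = s⁻¹ := by rw [hs, inv_div]
  have hb := sum_rpow_bound s hs0 hsle n
  refine htr.trans ?_
  calc ∑ j ∈ Finset.range n, μ (j + 1)
      ≤ ∑ j ∈ Finset.range n, M * ((j : ℝ) + 1) ^ (s - 1) := by
        refine Finset.sum_le_sum fun j _ => ?_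
        have := hbound (j + 1) (by omega)
        rw [hse] at this
        exact_mod_cast this
    _ = M * ∑ j ∈ Finset.range n, ((j : ℝ) + 1) ^ (s - 1) := by rw [Finset.mul_sum]
    _ ≤ M * (s⁻¹ * (n : ℝ) ^ s) := by
        refine mul_le_mul_of_nonneg_left ?_ hM.le
        rw [← div_eq_inv_mul, le_div_iff₀ hs0, mul_comm]
        exact hb
    _ = M * ((d : ℝ) / ((d : ℝ) - 2)) * (n : ℝ) ^ s := by rw [hinv, mul_assoc]
end
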